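/- Suppose X₁(0,0) ≠ 0. Let u be analytic in a neighborhood of (0,0), not identically zero, and satisfy X(u) = B₀·u in a neighborhood of (0,0). Then there exists a function ω, analytic in a neighborhood of (0,0), with ω(0,0) = 0, X₁·∂₁ω + X₂·∂₂ω = 0 and ∂₂ω = u in a neighborhood of (0,0); in particular ω is a first integral of X at (0,0). -/

import Mathlib

open Filter MvPolynomial

/-- Evaluation of a polynomial in two variables at a point of `ℂ × ℂ`. -/
noncomputable def pev (P : MvPolynomial (Fin 2) ℂ) (p : ℂ × ℂ) : ℂ :=
  MvPolynomial.eval ![p.1, p.2] P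

/-- Partial derivative with respect to the first variable. -/
noncomputable def d1 : (ℂ × ℂ → ℂ) → (ℂ × ℂ → ℂ) :=
  fun f p => deriv (fun x => f (x, p.2)) p.1

/-- Partial derivative with respect to the second variable. -/
noncomputable def d2 : (ℂ × ℂ → ℂ) → (ℂ × ℂ → ℂ) :=
  fun f p => deriv (fun y => f (p.1, y)) p.2

/-- The differential operator `X(g) = X₁·∂₁g + X₂·∂₂g`. -/
noncomputable def Xop (X₁ X₂ : MvPolynomial (Fin 2) ℂ) (f : ℂ × ℂ → ℂ) : ℂ × ℂ → ℂ :=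
  fun p => pev X₁ p * d1 f p + pev X₂ p * d2 f p

/-- A first integral of `X` at `p`: a nonconstant function, analytic near `p`,
annihilated by `X` near `p`. -/
def IsFirstIntegralAt (X₁ X₂ : MvPolynomial (Fin 2) ℂ) (ω : ℂ × ℂ → ℂ) (p : ℂ × ℂ) : Prop :=
  AnalyticAt ℂ ω p ∧ (∀ᶠ q in nhds p, Xop X₁ X₂ ω q = 0) ∧
    ¬ ∃ c : ℂ, ∀ᶠ q in nhds p, ω q = c

/-- The functions `Bᵢ = −X₁·∂₂^{i+1}(X₂/X₁)`. -/
noncomputable def B (X₁ X₂ : MvPolynomial (Fin 2) ℂ) (i : ℕ) : ℂ × ℂ → ℂ :=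
  fun p => -(pev X₁ p) * (d2^[i + 1] (fun q => pev X₂ q / pev X₁ q)) p

/-- Integrating a power series of `1`-forms along segments from its centre yields a power series
on the same ball. -/
theorem HasFPowerSeriesOnBall.curveIntegral_segment
    {E F : Type*} [NormedAddCommGroup E] [NormedSpace ℂ E]
    [NormedAddCommGroup F] [NormedSpace ℂ F] [CompleteSpace F]
    {η : E → E →L[ℂ] F} {p : FormalMultilinearSeries ℂ E (E →L[ℂ] F)} {a : E} {r : ENNReal}
    (hη : HasFPowerSeriesOnBall η p a r) :
    HasFPowerSeriesOnBall (fun b => curveIntegral η (.segment a b))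
      (fun n => (n : ℂ)⁻¹ • p.unshift 0 n) a r where
  r_le := by
    refine hη.r_le.trans ?_
    rw [← p.radius_unshift 0]
    refine FormalMultilinearSeries.radius_le_of_le fun n => ?_
    rw [norm_smul, norm_inv, Complex.norm_natCast]
    exact mul_le_of_le_one_left (norm_nonneg _) (Nat.cast_inv_le_one n)
  r_pos := hη.r_pos
  hasSum := by
    intro y hy
    have hsum : HasSum (fun n => ∫ t in (0 : ℝ)..1, p n (fun _ => (t : ℂ) • y) y)
        (∫ t in (0 : ℝ)..1, η (a + (t : ℂ) • y) y) := by
      have hy' : (‖y‖₊ : ENNReal) < p.radius := by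
        refine lt_of_lt_of_le ?_ hη.r_le
        simpa [enorm] using hy
      have hbound : Summable fun n => ‖p n‖ * ‖y‖ ^ n * ‖y‖ :=
        (p.summable_norm_mul_pow hy').mul_right _
      refine intervalIntegral.hasSum_integral_of_dominated_convergence
        (fun n _ => ‖p n‖ * ‖y‖ ^ n * ‖y‖) (fun n => ?_) (fun n => ?_) ?_ ?_ ?_
      · refine Continuous.aestronglyMeasurable ?_
        have : Continuous fun t : ℝ => p n fun _ => (t : ℂ) • y :=
          (p n).cont.comp (by fun_prop)
        exact this.clm_apply continuous_const
      · refine .of_forall fun t ht => ?_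
        rw [Set.uIoc_of_le zero_le_one] at ht
        refine (ContinuousLinearMap.le_opNorm _ _).trans ?_
        gcongr
        refine (ContinuousMultilinearMap.le_opNorm _ _).trans ?_
        simp only [Finset.prod_const, Finset.card_univ, Fintype.card_fin]
        gcongr
        rw [norm_smul, Complex.norm_real, Real.norm_of_nonneg ht.1.le]
        exact mul_le_of_le_one_left (norm_nonneg _) ht.2
      · exact .of_forall fun _ _ => hbound
      · exact intervalIntegrable_const
      · refine .of_forall fun t ht => ?_
        rw [Set.uIoc_of_le zero_le_one] at ht
        refine (ContinuousLinearMap.apply ℂ F y).hasSum (hη.hasSum ?_)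
        rw [mem_eball_zero_iff] at hy ⊢
        refine lt_of_le_of_lt ?_ hy
        rw [enorm_le_iff_norm_le, norm_smul, Complex.norm_real, Real.norm_of_nonneg ht.1.le]
        exact mul_le_of_le_one_left (norm_nonneg _) ht.2
    let : NormedSpace ℝ E := .restrictScalars ℝ ℂ E
    have hint : curveIntegral η (.segment a (a + y)) =
        ∫ t in (0 : ℝ)..1, η (a + (t : ℂ) • y) y := by
      rw [_root_.curveIntegral_segment]
      refine intervalIntegral.integral_congr fun t _ => ?_
      simp only [AffineMap.lineMap_apply, vsub_eq_sub, add_sub_cancel_left, vadd_eq_add]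
      rw [add_comm]
      rfl
    rw [hint, ← hasSum_nat_add_iff' 1]
    convert! hsum using 1
    · funext n
      have h : ∀ t : ℝ, p n (fun _ => (t : ℂ) • y) y = ((t ^ n : ℝ) : ℂ) • p n (fun _ => y) y := by
        intro t
        have := (p n).map_smul_univ (fun _ => (t : ℂ)) (fun _ => y)
        rw [this, Finset.prod_const, Finset.card_univ, Fintype.card_fin, Complex.ofReal_pow]
        rfl
      simp_rw [h, Complex.coe_smul]
      rw [intervalIntegral.integral_smul_const, integral_pow]
      simp [FormalMultilinearSeries.unshift, Fin.init_def, ← Complex.coe_smul]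
    · simp

theorem AnalyticAt.curveIntegral_segment
    {E F : Type*} [NormedAddCommGroup E] [NormedSpace ℂ E]
    [NormedAddCommGroup F] [NormedSpace ℂ F] [CompleteSpace F]
    {η : E → E →L[ℂ] F} {a : E} (hη : AnalyticAt ℂ η a) :
    AnalyticAt ℂ (fun b => curveIntegral η (.segment a b)) a :=
  let ⟨_, _, h⟩ := hη
  h.curveIntegral_segment.analyticAt

/-- A holomorphic `1`-form that is closed near `a` has a holomorphic primitive near `a`. -/
theorem AnalyticAt.exists_primitive_of_fderiv_symmetric
    {E F : Type*} [NormedAddCommGroup E] [NormedSpace ℂ E]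
    [NormedAddCommGroup F] [NormedSpace ℂ F] [CompleteSpace F]
    {η : E → E →L[ℂ] F} {a : E} (hη : AnalyticAt ℂ η a)
    (hsymm : ∀ᶠ q in nhds a, ∀ v w, fderiv ℂ η q v w = fderiv ℂ η q w v) :
    ∃ ω : E → F, AnalyticAt ℂ ω a ∧ ω a = 0 ∧ ∀ᶠ q in nhds a, HasFDerivAt ω (η q) q := by
  refine ⟨_, hη.curveIntegral_segment, by simp, ?_⟩
  obtain ⟨ε, hε, hball⟩ :=
    Metric.eventually_nhds_iff_ball.1 (hη.eventually_analyticAt.and hsymm)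
  let : NormedSpace ℝ E := .restrictScalars ℝ ℂ E
  filter_upwards [Metric.ball_mem_nhds a hε] with b hb
  refine ((convex_ball a ε).hasFDerivWithinAt_curveIntegral_segment_of_hasFDerivWithinAt_symmetric
    (dω := fun q => (fderiv ℂ η q).restrictScalars ℝ) (fun q hq => ?_) (fun q hq v _ w _ => ?_)
    (Metric.mem_ball_self hε) hb).hasFDerivAt (Metric.isOpen_ball.mem_nhds hb)
  · exact ((hball q hq).1.differentiableAt.hasFDerivAt.restrictScalars ℝ).hasFDerivWithinAt
  · exact (hball q hq).2 v w

theorem HasFDerivAt.d1_eq {f : ℂ × ℂ → ℂ} {f' : ℂ × ℂ →L[ℂ] ℂ} {q : ℂ × ℂ}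
    (h : HasFDerivAt f f' q) : d1 f q = f' (1, 0) :=
  (HasFDerivAt.comp_hasDerivAt (f := fun x => (x, q.2)) q.1 h
    ((hasDerivAt_id q.1).prodMk (hasDerivAt_const q.1 q.2))).deriv

theorem HasFDerivAt.d2_eq {f : ℂ × ℂ → ℂ} {f' : ℂ × ℂ →L[ℂ] ℂ} {q : ℂ × ℂ}
    (h : HasFDerivAt f f' q) : d2 f q = f' (0, 1) :=
  (HasFDerivAt.comp_hasDerivAt (f := fun y => (q.1, y)) q.2 h
    ((hasDerivAt_const q.2 q.1).prodMk (hasDerivAt_id q.2))).deriv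

theorem ContinuousLinearMap.apply_prod_complex (L : ℂ × ℂ →L[ℂ] ℂ) (v : ℂ × ℂ) :
    L v = v.1 * L (1, 0) + v.2 * L (0, 1) := by
  have hv : v = v.1 • ((1, 0) : ℂ × ℂ) + v.2 • ((0, 1) : ℂ × ℂ) := by ext <;> simp
  conv_lhs => rw [hv]
  simp only [map_add, map_smul, smul_eq_mul]

theorem analyticAt_pev (P : MvPolynomial (Fin 2) ℂ) (q : ℂ × ℂ) : AnalyticAt ℂ (pev P) q := by
  refine AnalyticAt.aeval_mvPolynomial (f := fun p : ℂ × ℂ => ![p.1, p.2]) (fun i => ?_) P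
  fin_cases i
  · exact analyticAt_fst
  · exact analyticAt_snd

/-- The `1`-form `u·(dx₂ − R·dx₁)`, whose primitives `ω` satisfy `∂₁ω = −R·u` and `∂₂ω = u`. -/
noncomputable def slopeForm (u R : ℂ × ℂ → ℂ) (q : ℂ × ℂ) : ℂ × ℂ →L[ℂ] ℂ :=
  u q • (ContinuousLinearMap.snd ℂ ℂ ℂ - R q • ContinuousLinearMap.fst ℂ ℂ ℂ)

theorem AnalyticAt.slopeForm {u R : ℂ × ℂ → ℂ} {q : ℂ × ℂ} (hu : AnalyticAt ℂ u q)
    (hR : AnalyticAt ℂ R q) : AnalyticAt ℂ (slopeForm u R) q :=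
  hu.smul (analyticAt_const.sub (hR.smul analyticAt_const))

/-- `slopeForm u R` is closed where `∂₁u + ∂₂(R·u) = 0`. -/
theorem fderiv_slopeForm_symmetric {u R : ℂ × ℂ → ℂ} {q : ℂ × ℂ} (hu : DifferentiableAt ℂ u q)
    (hR : DifferentiableAt ℂ R q) (h : d1 u q + R q * d2 u q + d2 R q * u q = 0) (v w : ℂ × ℂ) :
    fderiv ℂ (slopeForm u R) q v w = fderiv ℂ (slopeForm u R) q w v := by
  have hd : HasFDerivAt (slopeForm u R) _ q :=
    hu.hasFDerivAt.smul ((hasFDerivAt_const _ q).sub (hR.hasFDerivAt.smul_const (ContinuousLinearMap.fst ℂ ℂ ℂ)))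
  rw [hu.hasFDerivAt.d1_eq, hu.hasFDerivAt.d2_eq, hR.hasFDerivAt.d2_eq] at h
  rw [hd.fderiv]
  simp
  rw [(fderiv ℂ u q).apply_prod_complex v, (fderiv ℂ u q).apply_prod_complex w,
    (fderiv ℂ R q).apply_prod_complex v, (fderiv ℂ R q).apply_prod_complex w]
  linear_combination (v.1 * w.2 - v.2 * w.1) * h

/-- a not-identically-zero analytic solution of `X(u) = B₀·u` near `(0,0)`
is `∂₂ω` for some first integral `ω` of `X` at `(0,0)` with `ω(0,0) = 0`. -/
theorem stmt_11 (X₁ X₂ : MvPolynomial (Fin 2) ℂ)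
    (hX₁ : pev X₁ ((0 : ℂ), (0 : ℂ)) ≠ 0)
    (u : ℂ × ℂ → ℂ) (hu : AnalyticAt ℂ u ((0 : ℂ), (0 : ℂ)))
    (hunz : ¬ ∀ᶠ q in nhds ((0 : ℂ), (0 : ℂ)), u q = 0)
    (hXu : ∀ᶠ q in nhds ((0 : ℂ), (0 : ℂ)),
      Xop X₁ X₂ u q = B X₁ X₂ 0 q * u q) :
    ∃ ω : ℂ × ℂ → ℂ, AnalyticAt ℂ ω ((0 : ℂ), (0 : ℂ)) ∧
      ω ((0 : ℂ), (0 : ℂ)) = 0 ∧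
      (∀ᶠ q in nhds ((0 : ℂ), (0 : ℂ)), Xop X₁ X₂ ω q = 0) ∧
      (∀ᶠ q in nhds ((0 : ℂ), (0 : ℂ)), d2 ω q = u q) ∧
      IsFirstIntegralAt X₁ X₂ ω ((0 : ℂ), (0 : ℂ)) := by
  set R : ℂ × ℂ → ℂ := fun q => pev X₂ q / pev X₁ q with hRdef
  have hR : AnalyticAt ℂ R (0, 0) := (analyticAt_pev X₂ _).div (analyticAt_pev X₁ _) hX₁
  have hne : ∀ᶠ q in nhds ((0 : ℂ), (0 : ℂ)), pev X₁ q ≠ 0 :=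
    (analyticAt_pev X₁ _).continuousAt.eventually_ne hX₁
  have hsymm : ∀ᶠ q in nhds ((0 : ℂ), (0 : ℂ)), ∀ v w,
      fderiv ℂ (slopeForm u R) q v w = fderiv ℂ (slopeForm u R) q w v := by
    filter_upwards [hu.eventually_analyticAt, hR.eventually_analyticAt, hne, hXu]
      with q huq hRq hq hXq
    refine fderiv_slopeForm_symmetric huq.differentiableAt hRq.differentiableAt ?_
    simp only [Xop, B, zero_add, Function.iterate_one, ← hRdef] at hXq
    have hX₂ : pev X₂ q = R q * pev X₁ q := (div_mul_cancel₀ _ hq).symm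
    rw [hX₂] at hXq
    refine mul_left_cancel₀ hq ?_
    linear_combination hXq
  obtain ⟨ω, hω, hω0, hdω⟩ := (hu.slopeForm hR).exists_primitive_of_fderiv_symmetric hsymm
  have hd2 : ∀ᶠ q in nhds ((0 : ℂ), (0 : ℂ)), d2 ω q = u q :=
    hdω.mono fun q hq => by simp [hq.d2_eq, slopeForm]
  have hX : ∀ᶠ q in nhds ((0 : ℂ), (0 : ℂ)), Xop X₁ X₂ ω q = 0 := by
    filter_upwards [hdω, hne] with q hq hq₁
    simp only [Xop, hq.d1_eq, hq.d2_eq, slopeForm, hRdef]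
    simp
    field_simp
    ring
  refine ⟨ω, hω, hω0, hX, hd2, hω, hX, ?_⟩
  rintro ⟨c, hc⟩
  refine hunz ?_
  filter_upwards [hd2, hc.eventually_nhds] with q hq hcq
  have h : HasFDerivAt ω (0 : ℂ × ℂ →L[ℂ] ℂ) q := (hasFDerivAt_const c q).congr_of_eventuallyEq hcq
  rw [← hq, h.d2_eq, _root_.zero_apply]
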